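/- Under Conditions 1, 2, 3, 4, 5, 7, and Conditions 9, 10 and 11, the maximum likelihood estimator computed from the approximated inputs is consistent: θ̂_{n,N_n} converges to θ₀ in probability as n → ∞. -/

import Mathlib

open MeasureTheory ProbabilityTheory Filter
open scoped RealInnerProductSpace Topology ENNReal Matrix

/-- The covariance matrix `R_θ = (K_θ(f_i - f_j))_{1 ≤ i,j ≤ n}` built from the inputs `f`. -/
noncomputable def covMatrix {H : Type*} [NormedAddCommGroup H] [InnerProductSpace ℝ H]
    {p : ℕ} (K : EuclideanSpace ℝ (Fin p) → H → ℝ) (f : (n : ℕ) → Fin n → H)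
    (n : ℕ) (θ : EuclideanSpace ℝ (Fin p)) : Matrix (Fin n) (Fin n) ℝ :=
  Matrix.of fun i j => K θ (f n i - f n j)

/-- The modified negative log Gaussian likelihood built from the inputs `f`. -/
noncomputable def negLogLik {H : Type*} [NormedAddCommGroup H] [InnerProductSpace ℝ H]
    {p : ℕ} (K : EuclideanSpace ℝ (Fin p) → H → ℝ) (f : (n : ℕ) → Fin n → H)
    {Ω : Type*} (y : (n : ℕ) → Ω → (Fin n → ℝ))
    (n : ℕ) (θ : EuclideanSpace ℝ (Fin p)) (ω : Ω) : ℝ :=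
  (1 / (n : ℝ)) * Real.log (covMatrix K f n θ).det
    + (1 / (n : ℝ)) * (y n ω ⬝ᵥ (covMatrix K f n θ)⁻¹.mulVec (y n ω))

lemma Matrix.IsHermitian.exists_eq_mul_diagonal_mul_transpose {n : ℕ}
    {M : Matrix (Fin n) (Fin n) ℝ} (hM : M.IsHermitian) :
    ∃ (U : Matrix (Fin n) (Fin n) ℝ) (l : Fin n → ℝ),
      Uᵀ * U = 1 ∧ U * Uᵀ = 1 ∧ M = U * Matrix.diagonal l * Uᵀ := by
  refine ⟨hM.eigenvectorUnitary.1, hM.eigenvalues, ?_, ?_, ?_⟩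
  · rw [← Matrix.conjTranspose_eq_transpose_of_trivial]
    exact Unitary.coe_star_mul_self hM.eigenvectorUnitary
  · rw [← Matrix.conjTranspose_eq_transpose_of_trivial]
    exact Unitary.coe_mul_star_self hM.eigenvectorUnitary
  · rw [← Matrix.conjTranspose_eq_transpose_of_trivial]
    exact hM.spectral_theorem

/-- Two symmetric bilinear forms, one of which is positive definite, are simultaneously
diagonalizable by congruence. -/
lemma Matrix.PosDef.exists_simultaneous_diagonalization {n : ℕ} {A B : Matrix (Fin n) (Fin n) ℝ}
    (hA : A.PosDef) (hB : B.IsHermitian) :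
    ∃ (P Q : Matrix (Fin n) (Fin n) ℝ) (l : Fin n → ℝ),
      Q * P = 1 ∧ A = P * Pᵀ ∧ B = P * Matrix.diagonal l * Pᵀ := by
  obtain ⟨S, hS⟩ : ∃ S : Matrix (Fin n) (Fin n) ℝ, A = Sᴴ * S := by
    open scoped MatrixOrder in
    exact CStarAlgebra.nonneg_iff_eq_star_mul_self.mp hA.posSemidef.nonneg
  rw [Matrix.conjTranspose_eq_transpose_of_trivial] at hS
  have hSu : IsUnit S.det := by
    have h := hA.det_pos
    rw [hS, Matrix.det_mul] at h
    exact isUnit_iff_ne_zero.2 fun h0 => by simp [h0] at h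
  have hSS : S⁻¹ * S = 1 := Matrix.nonsing_inv_mul _ hSu
  have hSS' : S * S⁻¹ = 1 := Matrix.mul_nonsing_inv _ hSu
  have hT : Sᵀ * S⁻¹ᵀ = 1 := by rw [← Matrix.transpose_mul, hSS, Matrix.transpose_one]
  have hT' : S⁻¹ᵀ * Sᵀ = 1 := by rw [← Matrix.transpose_mul, hSS', Matrix.transpose_one]
  have hM : (S⁻¹ᵀ * B * S⁻¹).IsHermitian := by
    simpa [Matrix.conjTranspose_eq_transpose_of_trivial] using
      Matrix.isHermitian_conjTranspose_mul_mul S⁻¹ hB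
  obtain ⟨U, l, hUU, hUU', hspec⟩ := hM.exists_eq_mul_diagonal_mul_transpose
  refine ⟨Sᵀ * U, Uᵀ * S⁻¹ᵀ, l, ?_, ?_, ?_⟩
  · calc Uᵀ * S⁻¹ᵀ * (Sᵀ * U) = Uᵀ * (S⁻¹ᵀ * Sᵀ) * U := by simp only [Matrix.mul_assoc]
      _ = 1 := by rw [hT', Matrix.mul_one, hUU]
  · calc A = Sᵀ * (U * Uᵀ) * S := by rw [hUU', Matrix.mul_one, hS]
      _ = _ := by simp only [Matrix.transpose_mul, Matrix.transpose_transpose, Matrix.mul_assoc]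
  · calc B = (Sᵀ * S⁻¹ᵀ) * B * (S⁻¹ * S) := by rw [hT, hSS, Matrix.mul_one, Matrix.one_mul]
      _ = Sᵀ * (S⁻¹ᵀ * B * S⁻¹) * S := by simp only [Matrix.mul_assoc]
      _ = _ := by
        rw [hspec]
        simp only [Matrix.transpose_mul, Matrix.transpose_transpose, Matrix.mul_assoc]

section Congruence

variable {n : ℕ} {P Q : Matrix (Fin n) (Fin n) ℝ} {l : Fin n → ℝ}

lemma dotProduct_mulVec_congruence (hQP : Q * P = 1) (k m : Fin n) :
    Q k ⬝ᵥ (P * Matrix.diagonal l * Pᵀ).mulVec (Q m) = if k = m then l k else 0 := by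
  have hT : Pᵀ * Qᵀ = 1 := by rw [← Matrix.transpose_mul, hQP, Matrix.transpose_one]
  have h : Q * (P * Matrix.diagonal l * Pᵀ) * Qᵀ = Matrix.diagonal l := by
    calc _ = (Q * P) * Matrix.diagonal l * (Pᵀ * Qᵀ) := by simp only [Matrix.mul_assoc]
      _ = _ := by rw [hQP, hT, Matrix.mul_one, Matrix.one_mul]
  have hkm := congrFun (congrFun h k) m
  rw [Matrix.diagonal_apply] at hkm
  rw [← hkm]
  generalize P * Matrix.diagonal l * Pᵀ = B
  rw [Matrix.mul_assoc, Matrix.mul_apply]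
  simp only [dotProduct, Matrix.mulVec, Matrix.mul_apply, Matrix.transpose_apply]

lemma inv_congruence (hQP : Q * P = 1) (hl : ∀ k, l k ≠ 0) :
    (P * Matrix.diagonal l * Pᵀ)⁻¹ = Qᵀ * Matrix.diagonal (fun k => (l k)⁻¹) * Q := by
  have hPQ : P * Q = 1 := mul_eq_one_comm.1 hQP
  have hT : Pᵀ * Qᵀ = 1 := by rw [← Matrix.transpose_mul, hQP, Matrix.transpose_one]
  apply Matrix.inv_eq_right_inv
  calc _ = P * (Matrix.diagonal l * (Pᵀ * Qᵀ) * Matrix.diagonal (fun k => (l k)⁻¹)) * Q := by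
        simp only [Matrix.mul_assoc]
    _ = 1 := by
        rw [hT, Matrix.mul_one, Matrix.diagonal_mul_diagonal]
        simp [hl, hPQ]

lemma dotProduct_inv_congruence (hQP : Q * P = 1) (hl : ∀ k, l k ≠ 0) (v : Fin n → ℝ) :
    v ⬝ᵥ (P * Matrix.diagonal l * Pᵀ)⁻¹.mulVec v = ∑ k, (Q k ⬝ᵥ v) ^ 2 / l k := by
  rw [inv_congruence hQP hl, ← Matrix.mulVec_mulVec, ← Matrix.mulVec_mulVec,
    Matrix.dotProduct_mulVec, Matrix.vecMul_transpose]
  simp only [dotProduct, Matrix.mulVec_diagonal]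
  refine Finset.sum_congr rfl fun k _ => ?_
  simp only [Matrix.mulVec, dotProduct]
  ring

lemma log_det_congruence (hQP : Q * P = 1) (hl : ∀ k, l k ≠ 0) :
    Real.log (P * Matrix.diagonal l * Pᵀ).det = Real.log (P * Pᵀ).det + ∑ k, Real.log (l k) := by
  have hP : P.det ≠ 0 := by
    have h := congrArg Matrix.det hQP
    rw [Matrix.det_mul, Matrix.det_one] at h
    exact right_ne_zero_of_mul_eq_one h
  rw [Matrix.det_mul, Matrix.det_mul, Matrix.det_mul, Matrix.det_transpose, Matrix.det_diagonal,
    ← Real.log_prod (fun k _ => hl k), ← Real.log_mul (mul_ne_zero hP hP)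
      (Finset.prod_ne_zero_iff.2 fun k _ => hl k)]
  congr 1
  ring

lemma trace_inv_mul_congruence (hQP : Q * P = 1) :
    ((P * Pᵀ)⁻¹ * (P * Matrix.diagonal l * Pᵀ)).trace = ∑ k, l k := by
  have h := inv_congruence (l := fun _ => (1 : ℝ)) hQP (by simp)
  have hT : Pᵀ * Qᵀ = 1 := by rw [← Matrix.transpose_mul, hQP, Matrix.transpose_one]
  simp only [Matrix.diagonal_one, Matrix.mul_one, inv_one] at h
  rw [h, Matrix.trace_mul_comm]
  calc _ = (P * Matrix.diagonal l * (Pᵀ * Qᵀ) * Q).trace := by simp only [Matrix.mul_assoc]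
    _ = ((Q * P) * Matrix.diagonal l).trace := by
        rw [hT, Matrix.mul_one, Matrix.trace_mul_comm, Matrix.mul_assoc]
    _ = _ := by rw [hQP, Matrix.one_mul, Matrix.trace_diagonal]

end Congruence

lemma posDef_of_forall_mul_sum_sq_le {n : ℕ} {A : Matrix (Fin n) (Fin n) ℝ} (hA : A.IsHermitian)
    {c : ℝ} (hc : 0 < c) (hAl : ∀ x : Fin n → ℝ, c * ∑ i, x i ^ 2 ≤ x ⬝ᵥ A.mulVec x) :
    A.PosDef := by
  refine Matrix.PosDef.of_dotProduct_mulVec_pos hA fun x hx => ?_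
  rw [star_trivial]
  refine lt_of_lt_of_le (mul_pos hc ?_) (hAl x)
  obtain ⟨i, hi⟩ := Function.ne_iff.1 hx
  exact Finset.sum_pos' (fun i _ => sq_nonneg _) ⟨i, Finset.mem_univ i, by
    have : x i ≠ 0 := hi
    positivity⟩

lemma abs_log_le_two_mul_of_abs_sub_one_le {x τ : ℝ} (hτ : τ ≤ 1 / 2) (hx : |x - 1| ≤ τ) :
    |Real.log x| ≤ 2 * τ := by
  obtain ⟨h1, h2⟩ := abs_le.1 hx
  have hx0 : 0 < x := by linarith
  have h3 := Real.log_le_sub_one_of_pos hx0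
  have h4 := Real.one_sub_inv_le_log_of_pos hx0
  have h5 : x⁻¹ ≤ 1 + 2 * τ := by
    rw [inv_le_iff_one_le_mul₀ hx0]
    nlinarith
  rw [abs_le]
  constructor <;> linarith

lemma abs_inv_sub_one_le_two_mul {x τ : ℝ} (hτ : τ ≤ 1 / 2) (hx : |x - 1| ≤ τ) :
    |x⁻¹ - 1| ≤ 2 * τ := by
  obtain ⟨h1, h2⟩ := abs_le.1 hx
  have hx0 : 0 < x := by linarith
  have h5 : x⁻¹ ≤ 1 + 2 * τ := by
    rw [inv_le_iff_one_le_mul₀ hx0]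
    nlinarith
  have h6 : 1 - 2 * τ ≤ x⁻¹ := by
    rw [inv_eq_one_div, le_div_iff₀ hx0]
    nlinarith
  rw [abs_le]
  constructor <;> linarith

lemma sq_sub_one_le_mul_sub_one_sub_log {x b : ℝ} (hx : 0 < x) (hxb : x ≤ b) :
    (x - 1) ^ 2 ≤ 2 * (b + 1) * (x - 1 - Real.log x) := by
  have hs := Real.sqrt_pos.2 hx
  have hsq : √x ^ 2 = x := Real.sq_sqrt hx.le
  have hlog : Real.log x = 2 * Real.log √x := by
    rw [Real.log_sqrt hx.le]; ring
  have h1 := Real.log_le_sub_one_of_pos hs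
  have h2 : (√x - 1) ^ 2 ≤ x - 1 - Real.log x := by nlinarith
  have h3 : (x - 1) ^ 2 = (√x - 1) ^ 2 * (√x + 1) ^ 2 := by
    have h : (√x ^ 2 - 1) ^ 2 = (√x - 1) ^ 2 * (√x + 1) ^ 2 := by ring
    rwa [hsq] at h
  have h4 : (√x + 1) ^ 2 ≤ 2 * (b + 1) := by nlinarith [sq_nonneg (√x - 1)]
  rw [h3, mul_comm]
  exact mul_le_mul h4 h2 (sq_nonneg _) (by linarith)

/-- Stability of the two terms of the Gaussian likelihood under a relative perturbation of the
covariance matrix. -/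
lemma likelihood_terms_perturbation {n : ℕ} {A B : Matrix (Fin n) (Fin n) ℝ} (hA : A.PosDef)
    (hB : B.IsHermitian) {τ : ℝ} (hτ : τ ≤ 1 / 2)
    (hAB : ∀ x : Fin n → ℝ, |x ⬝ᵥ B.mulVec x - x ⬝ᵥ A.mulVec x| ≤ τ * (x ⬝ᵥ A.mulVec x)) :
    |Real.log B.det - Real.log A.det| ≤ 2 * τ * n ∧
      ∀ v : Fin n → ℝ, |v ⬝ᵥ B⁻¹.mulVec v - v ⬝ᵥ A⁻¹.mulVec v| ≤
        2 * τ * (v ⬝ᵥ A⁻¹.mulVec v) := by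
  obtain ⟨P, Q, l, hQP, hAP, hBP⟩ := hA.exists_simultaneous_diagonalization hB
  have hA1 : A = P * Matrix.diagonal (fun _ => (1 : ℝ)) * Pᵀ := by
    rw [Matrix.diagonal_one, Matrix.mul_one, hAP]
  have hl : ∀ k, |l k - 1| ≤ τ := fun k => by
    have h := hAB (Q k)
    rw [hBP, hA1, dotProduct_mulVec_congruence hQP, dotProduct_mulVec_congruence hQP] at h
    simpa using h
  have hl0 : ∀ k, l k ≠ 0 := fun k h => by
    have := hl k
    rw [h] at this
    norm_num at this
    linarith
  refine ⟨?_, fun v => ?_⟩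
  · rw [hBP, hAP, log_det_congruence hQP hl0, add_sub_cancel_left]
    refine (Finset.abs_sum_le_sum_abs _ _).trans ?_
    refine (Finset.sum_le_sum fun k _ => abs_log_le_two_mul_of_abs_sub_one_le hτ (hl k)).trans ?_
    simp [mul_comm]
  · rw [hBP, hA1, dotProduct_inv_congruence hQP hl0, dotProduct_inv_congruence hQP (by simp),
      ← Finset.sum_sub_distrib, Finset.mul_sum]
    refine (Finset.abs_sum_le_sum_abs _ _).trans (Finset.sum_le_sum fun k _ => ?_)
    have h : (Q k ⬝ᵥ v) ^ 2 / l k - (Q k ⬝ᵥ v) ^ 2 / 1 = ((l k)⁻¹ - 1) * (Q k ⬝ᵥ v) ^ 2 := by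
      ring
    rw [h, abs_mul, abs_of_nonneg (sq_nonneg (Q k ⬝ᵥ v)), div_one]
    exact mul_le_mul_of_nonneg_right (abs_inv_sub_one_le_two_mul hτ (hl k)) (sq_nonneg _)

section Bounds

variable {n : ℕ} {A B P Q : Matrix (Fin n) (Fin n) ℝ} {l : Fin n → ℝ} {c C : ℝ}

lemma congruence_coeff_mem_Ioc (hc : 0 < c)
    (hAl : ∀ x : Fin n → ℝ, c * ∑ i, x i ^ 2 ≤ x ⬝ᵥ A.mulVec x)
    (hBl : ∀ x : Fin n → ℝ, c * ∑ i, x i ^ 2 ≤ x ⬝ᵥ B.mulVec x)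
    (hBu : ∀ x : Fin n → ℝ, x ⬝ᵥ B.mulVec x ≤ C * ∑ i, x i ^ 2)
    (hQP : Q * P = 1) (hAP : A = P * Pᵀ) (hBP : B = P * Matrix.diagonal l * Pᵀ) (k : Fin n) :
    0 < l k ∧ l k ≤ C / c := by
  have hA1 : A = P * Matrix.diagonal (fun _ => (1 : ℝ)) * Pᵀ := by
    rw [Matrix.diagonal_one, Matrix.mul_one, hAP]
  have h1 := hAl (Q k)
  have h2 := hBl (Q k)
  have h3 := hBu (Q k)
  rw [hA1, dotProduct_mulVec_congruence hQP, if_pos rfl] at h1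
  rw [hBP, dotProduct_mulVec_congruence hQP, if_pos rfl] at h2 h3
  have hQk : 0 < ∑ i, Q k i ^ 2 := by
    refine (Finset.sum_nonneg fun i _ => sq_nonneg (Q k i)).lt_of_ne' fun h0 => ?_
    have hz : ∀ i, Q k i = 0 := fun i => by
      simpa using (Finset.sum_eq_zero_iff_of_nonneg fun i _ => sq_nonneg (Q k i)).1 h0 i
        (Finset.mem_univ i)
    have h := congrFun (congrFun hQP k) k
    simp [Matrix.mul_apply, hz] at h
  have hl : 0 < l k := (mul_pos hc hQk).trans_le h2
  refine ⟨hl, ?_⟩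
  have hC : 0 < C := by
    by_contra! hC
    nlinarith
  rw [le_div_iff₀ hc]
  nlinarith

lemma sum_sq_sub_le_mul_sum_sq (hC : 0 ≤ C)
    (hAu : ∀ x : Fin n → ℝ, x ⬝ᵥ A.mulVec x ≤ C * ∑ i, x i ^ 2)
    (hAP : A = P * Pᵀ) (hBP : B = P * Matrix.diagonal l * Pᵀ) :
    ∑ i, ∑ j, (A i j - B i j) ^ 2 ≤ C ^ 2 * ∑ k, (l k - 1) ^ 2 := by
  set G : Fin n → Fin n → ℝ := fun k m => ∑ i, P i k * P i m with hG
  have hsub : ∀ i j, A i j - B i j = ∑ k, (1 - l k) * (P i k * P j k) := fun i j => by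
    rw [hAP, hBP, Matrix.mul_apply, Matrix.mul_apply, ← Finset.sum_sub_distrib]
    refine Finset.sum_congr rfl fun k _ => ?_
    rw [Matrix.mul_diagonal, Matrix.transpose_apply]
    ring
  have hexp : ∑ i, ∑ j, (A i j - B i j) ^ 2
      = ∑ k, ∑ m, (1 - l k) * (1 - l m) * G k m ^ 2 := by
    simp_rw [hsub, sq, Finset.sum_mul_sum, hG, Finset.sum_mul_sum, Finset.mul_sum]
    calc _ = ∑ i, ∑ k, ∑ j, ∑ m, (1 - l k) * (P i k * P j k) * ((1 - l m) * (P i m * P j m)) :=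
          Finset.sum_congr rfl fun i _ => Finset.sum_comm
      _ = ∑ k, ∑ i, ∑ j, ∑ m, (1 - l k) * (P i k * P j k) * ((1 - l m) * (P i m * P j m)) :=
          Finset.sum_comm
      _ = ∑ k, ∑ i, ∑ m, ∑ j, (1 - l k) * (P i k * P j k) * ((1 - l m) * (P i m * P j m)) :=
          Finset.sum_congr rfl fun k _ => Finset.sum_congr rfl fun i _ => Finset.sum_comm
      _ = ∑ k, ∑ m, ∑ i, ∑ j, (1 - l k) * (P i k * P j k) * ((1 - l m) * (P i m * P j m)) :=
          Finset.sum_congr rfl fun k _ => Finset.sum_comm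
      _ = _ := by
          refine Finset.sum_congr rfl fun k _ => Finset.sum_congr rfl fun m _ =>
            Finset.sum_congr rfl fun i _ => Finset.sum_congr rfl fun j _ => ?_
          ring
  have hrow : ∀ k, ∑ m, G k m ^ 2 ≤ C ^ 2 := fun k => by
    have h1 : ∑ m, G k m ^ 2 ≤ C * G k k := by
      have h := hAu (fun i => P i k)
      rw [hAP, ← Matrix.mulVec_mulVec, Matrix.dotProduct_mulVec, Matrix.mulVec_transpose] at h
      simp only [dotProduct, Matrix.vecMul] at h
      simpa only [hG, sq] using h
    have h2 : G k k ^ 2 ≤ ∑ m, G k m ^ 2 :=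
      Finset.single_le_sum (f := fun m => G k m ^ 2) (fun m _ => sq_nonneg _) (Finset.mem_univ k)
    have h3 : 0 ≤ G k k := Finset.sum_nonneg fun i _ => mul_self_nonneg _
    have h4 : G k k ≤ C := by
      by_contra! h
      nlinarith
    nlinarith
  have hsymm : ∀ k m, G k m = G m k := fun k m =>
    Finset.sum_congr rfl fun i _ => mul_comm _ _
  rw [hexp]
  calc ∑ k, ∑ m, (1 - l k) * (1 - l m) * G k m ^ 2
      ≤ ∑ k, ∑ m, (((l k - 1) ^ 2 * G k m ^ 2) / 2 + ((l m - 1) ^ 2 * G m k ^ 2) / 2) := by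
        refine Finset.sum_le_sum fun k _ => Finset.sum_le_sum fun m _ => ?_
        rw [hsymm m k]
        nlinarith [mul_nonneg (sq_nonneg (l k - l m)) (sq_nonneg (G k m))]
    _ = ∑ k, ∑ m, (l k - 1) ^ 2 * G k m ^ 2 := by
        simp_rw [Finset.sum_add_distrib]
        rw [Finset.sum_comm (f := fun k m => (l m - 1) ^ 2 * G m k ^ 2 / 2)]
        simp_rw [← Finset.sum_add_distrib, add_halves]
    _ ≤ C ^ 2 * ∑ k, (l k - 1) ^ 2 := by
        rw [Finset.mul_sum]
        refine Finset.sum_le_sum fun k _ => ?_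
        rw [← Finset.mul_sum, mul_comm]
        exact mul_le_mul_of_nonneg_right (hrow k) (sq_nonneg _)

/-- The Kullback–Leibler divergence between two centered Gaussian vectors controls the squared
Frobenius distance between their covariance matrices. -/
lemma sum_sq_sub_le_mul_klDiv (hA : A.IsHermitian) (hB : B.IsHermitian) (hc : 0 < c) (hC : 0 ≤ C)
    (hAl : ∀ x : Fin n → ℝ, c * ∑ i, x i ^ 2 ≤ x ⬝ᵥ A.mulVec x)
    (hAu : ∀ x : Fin n → ℝ, x ⬝ᵥ A.mulVec x ≤ C * ∑ i, x i ^ 2)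
    (hBl : ∀ x : Fin n → ℝ, c * ∑ i, x i ^ 2 ≤ x ⬝ᵥ B.mulVec x)
    (hBu : ∀ x : Fin n → ℝ, x ⬝ᵥ B.mulVec x ≤ C * ∑ i, x i ^ 2) :
    ∑ i, ∑ j, (A i j - B i j) ^ 2 ≤ C ^ 2 * (2 * (C / c + 1)) *
      (Real.log A.det + (A⁻¹ * B).trace - (Real.log B.det + n)) := by
  obtain ⟨P, Q, l, hQP, hAP, hBP⟩ :=
    (posDef_of_forall_mul_sum_sq_le hA hc hAl).exists_simultaneous_diagonalization hB
  have hl := congruence_coeff_mem_Ioc hc hAl hBl hBu hQP hAP hBP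
  refine (sum_sq_sub_le_mul_sum_sq hC hAu hAP hBP).trans ?_
  rw [mul_assoc]
  refine mul_le_mul_of_nonneg_left ?_ (sq_nonneg C)
  have h : Real.log A.det + (A⁻¹ * B).trace - (Real.log B.det + n)
      = ∑ k, (l k - 1 - Real.log (l k)) := by
    rw [hBP, hAP, trace_inv_mul_congruence hQP, log_det_congruence hQP fun k => (hl k).1.ne']
    simp only [Finset.sum_sub_distrib, Finset.sum_const, Finset.card_univ, Fintype.card_fin,
      nsmul_eq_mul, mul_one]
    ring
  rw [h, Finset.mul_sum]
  exact Finset.sum_le_sum fun k _ => sq_sub_one_le_mul_sub_one_sub_log (hl k).1 (hl k).2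

lemma trace_inv_mul_le (hA : A.IsHermitian) (hB : B.IsHermitian) (hc : 0 < c)
    (hAl : ∀ x : Fin n → ℝ, c * ∑ i, x i ^ 2 ≤ x ⬝ᵥ A.mulVec x)
    (hBl : ∀ x : Fin n → ℝ, c * ∑ i, x i ^ 2 ≤ x ⬝ᵥ B.mulVec x)
    (hBu : ∀ x : Fin n → ℝ, x ⬝ᵥ B.mulVec x ≤ C * ∑ i, x i ^ 2) :
    (A⁻¹ * B).trace ≤ C / c * n := by
  obtain ⟨P, Q, l, hQP, hAP, hBP⟩ :=
    (posDef_of_forall_mul_sum_sq_le hA hc hAl).exists_simultaneous_diagonalization hB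
  have hl := congruence_coeff_mem_Ioc hc hAl hBl hBu hQP hAP hBP
  rw [hBP, hAP, trace_inv_mul_congruence hQP]
  refine (Finset.sum_le_sum fun k _ => (hl k).2).trans ?_
  simp [mul_comm]

end Bounds

lemma abs_dotProduct_mulVec_le_of_row_sum_le {n : ℕ} {M : Matrix (Fin n) (Fin n) ℝ}
    (hM : ∀ i j, M i j = M j i) {ε : ℝ} (hrow : ∀ i, ∑ j, |M i j| ≤ ε) (x : Fin n → ℝ) :
    |x ⬝ᵥ M.mulVec x| ≤ ε * ∑ i, x i ^ 2 := by
  have h : x ⬝ᵥ M.mulVec x = ∑ i, ∑ j, x i * (M i j * x j) := by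
    simp only [dotProduct, Matrix.mulVec, Finset.mul_sum]
  rw [h]
  calc |∑ i, ∑ j, x i * (M i j * x j)| ≤ ∑ i, ∑ j, |x i * (M i j * x j)| :=
        (Finset.abs_sum_le_sum_abs _ _).trans
          (Finset.sum_le_sum fun i _ => Finset.abs_sum_le_sum_abs _ _)
    _ ≤ ∑ i, ∑ j, (x i ^ 2 * |M i j| / 2 + x j ^ 2 * |M j i| / 2) := by
        refine Finset.sum_le_sum fun i _ => Finset.sum_le_sum fun j _ => ?_
        rw [hM j i, abs_mul, abs_mul, ← sq_abs (x i), ← sq_abs (x j)]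
        nlinarith [mul_nonneg (abs_nonneg (M i j)) (sq_nonneg (|x i| - |x j|))]
    _ = ∑ i, ∑ j, x i ^ 2 * |M i j| := by
        simp_rw [Finset.sum_add_distrib]
        rw [Finset.sum_comm (f := fun i j => x j ^ 2 * |M j i| / 2)]
        simp_rw [← Finset.sum_add_distrib, add_halves]
    _ ≤ ε * ∑ i, x i ^ 2 := by
        rw [Finset.mul_sum]
        refine Finset.sum_le_sum fun i _ => ?_
        rw [← Finset.mul_sum, mul_comm]
        exact mul_le_mul_of_nonneg_right (hrow i) (sq_nonneg _)

lemma integral_pow_four_gaussianReal (v : NNReal) :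
    ∫ x, x ^ 4 ∂gaussianReal 0 v = 3 * (v : ℝ) ^ 2 := by
  have h : ∫ x, x ^ 4 ∂gaussianReal 0 v
      = iteratedDeriv 4 (mgf (fun x ↦ x) (gaussianReal 0 v)) 0 := by
    rw [iteratedDeriv_mgf_zero] <;> simp
  set g : ℝ → ℝ := fun t => Real.exp (v * t ^ 2 / 2)
  have hg : ∀ t, HasDerivAt g (v * t * g t) t := fun t => by
    have h1 : HasDerivAt (fun t : ℝ => v * t ^ 2 / 2) (v * t) t :=
      (((hasDerivAt_pow 2 t).const_mul (v : ℝ)).div_const 2).congr_deriv (by norm_num; ring)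
    exact h1.exp.congr_deriv (mul_comm _ _)
  have hmgf : mgf (fun x ↦ x) (gaussianReal 0 v) = g := by
    rw [mgf_fun_id_gaussianReal]
    simp [g]
  have hstep : ∀ q q' : ℝ → ℝ, (∀ t, HasDerivAt q (q' t) t) →
      deriv (fun t => q t * g t) = fun t => (q' t + v * t * q t) * g t := fun q q' hq =>
    funext fun t => by
      rw [((hq t).fun_mul (hg t)).deriv]
      ring
  have hlin : ∀ a t : ℝ, HasDerivAt (fun t : ℝ => a * t) a t := fun a t =>
    ((hasDerivAt_id t).const_mul a).congr_deriv (mul_one a)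
  have h1 : deriv g = fun t => (v * t) * g t := funext fun t => (hg t).deriv
  have h2 := hstep (fun t => v * t) (fun _ => v) (hlin v)
  have h3 := hstep (fun t => v + v * t * (v * t)) (fun t => 2 * (v : ℝ) ^ 2 * t) fun t =>
    (((hlin v t).fun_mul (hlin v t)).const_add (v : ℝ)).congr_deriv (by ring)
  have h4 := hstep (fun t => 2 * (v : ℝ) ^ 2 * t + v * t * (v + v * t * (v * t)))
    (fun t => 3 * (v : ℝ) ^ 2 + 3 * (v : ℝ) ^ 3 * t ^ 2) fun t =>
      ((hlin (2 * (v : ℝ) ^ 2) t).fun_add ((hlin v t).fun_mul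
        (((hlin v t).fun_mul (hlin v t)).const_add (v : ℝ)))).congr_deriv (by ring)
  rw [h, hmgf]
  simp only [iteratedDeriv_succ, iteratedDeriv_zero, h1, h2, h3, h4]
  simp [g]

section GaussianQuadratic

variable {Ω : Type*} [MeasurableSpace Ω] {P : Measure Ω}

lemma memLp_of_map_eq_gaussianReal {X : Ω → ℝ} (hX : Measurable X) {v : NNReal}
    (h : P.map X = gaussianReal 0 v) (q : NNReal) : MemLp X q P := by
  have h1 : MemLp id q (P.map X) := h ▸ memLp_id_gaussianReal q
  exact (memLp_map_measure_iff (by fun_prop) hX.aemeasurable).1 h1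

lemma integral_pow_four_of_map_eq_gaussianReal {X : Ω → ℝ} (hX : Measurable X) {v : ℝ} (hv : 0 ≤ v)
    (h : P.map X = gaussianReal 0 v.toNNReal) :
    Integrable (fun ω => X ω ^ 4) P ∧ ∫ ω, X ω ^ 4 ∂P = 3 * v ^ 2 := by
  constructor
  · have h4 := (memLp_of_map_eq_gaussianReal hX h 4).integrable_norm_pow (by norm_num)
    refine h4.congr (Eventually.of_forall fun ω => ?_)
    simp [Even.pow_abs (show Even 4 by decide)]
  · rw [← integral_map (f := fun x => x ^ 4) hX.aemeasurable (by fun_prop), h,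
      integral_pow_four_gaussianReal, Real.coe_toNNReal v hv]

lemma integral_sq_of_map_eq_gaussianReal {X : Ω → ℝ} (hX : Measurable X) {v : ℝ} (hv : 0 ≤ v)
    (h : P.map X = gaussianReal 0 v.toNNReal) : ∫ ω, X ω ^ 2 ∂P = v := by
  rw [← integral_map (f := fun x => x ^ 2) hX.aemeasurable (by fun_prop), h]
  have h1 := variance_fun_id_gaussianReal (μ := 0) (v := v.toNNReal)
  rw [variance_eq_integral measurable_id'.aemeasurable] at h1
  simpa [integral_id_gaussianReal, hv] using h1

variable [IsProbabilityMeasure P]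

/-- Chebyshev's inequality for a sum of squares of uncorrelated Gaussian variables. -/
lemma measure_le_abs_sum_sq_sub_le {n : ℕ} {X : Fin n → Ω → ℝ} (hX : ∀ k, Measurable (X k))
    {l : Fin n → ℝ} (hl : ∀ k, 0 ≤ l k)
    (hXk : ∀ k, P.map (X k) = gaussianReal 0 (l k).toNNReal)
    (hadd : ∀ k m, k ≠ m → P.map (fun ω => X k ω + X m ω) = gaussianReal 0 (l k + l m).toNNReal)
    (hsub : ∀ k m, k ≠ m → P.map (fun ω => X k ω - X m ω) = gaussianReal 0 (l k + l m).toNNReal)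
    {t : ℝ} (ht : 0 < t) :
    P {ω | t ≤ |∑ k, X k ω ^ 2 - ∑ k, l k|} ≤ ENNReal.ofReal ((2 * ∑ k, l k ^ 2) / t ^ 2) := by
  have hmem : ∀ k, MemLp (fun ω => X k ω ^ 2) 2 P := fun k => by
    rw [memLp_two_iff_integrable_sq ((hX k).pow_const 2).aestronglyMeasurable]
    simpa [← pow_mul] using (integral_pow_four_of_map_eq_gaussianReal (hX k) (hl k) (hXk k)).1
  have hS : MemLp (fun ω => ∑ k, X k ω ^ 2) 2 P := memLp_finsetSum _ fun k _ => hmem k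
  have hES : ∫ ω, ∑ k, X k ω ^ 2 ∂P = ∑ k, l k := by
    rw [integral_finsetSum _ fun k _ => (hmem k).integrable (by norm_num)]
    exact Finset.sum_congr rfl fun k _ => integral_sq_of_map_eq_gaussianReal (hX k) (hl k) (hXk k)
  have hprod : ∀ k m, ∫ ω, X k ω ^ 2 * X m ω ^ 2 ∂P
      = l k * l m + if k = m then 2 * l k ^ 2 else 0 := fun k m => by
    by_cases hkm : k = m
    · subst hkm
      have h := (integral_pow_four_of_map_eq_gaussianReal (hX k) (hl k) (hXk k)).2
      simp only [← pow_add, if_true]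
      norm_num
      rw [h]
      ring
    · have hlkm := add_nonneg (hl k) (hl m)
      have i1 := integral_pow_four_of_map_eq_gaussianReal ((hX k).add (hX m)) hlkm (hadd k m hkm)
      have i2 := integral_pow_four_of_map_eq_gaussianReal ((hX k).sub (hX m)) hlkm (hsub k m hkm)
      have i3 := integral_pow_four_of_map_eq_gaussianReal (hX k) (hl k) (hXk k)
      have i4 := integral_pow_four_of_map_eq_gaussianReal (hX m) (hl m) (hXk m)
      have hpt : ∀ ω, X k ω ^ 2 * X m ω ^ 2 = (12 : ℝ)⁻¹ * ((X k ω + X m ω) ^ 4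
          + (X k ω - X m ω) ^ 4 - 2 * X k ω ^ 4 - 2 * X m ω ^ 4) := fun ω => by ring
      simp_rw [hpt]
      simp only [Pi.add_apply, Pi.sub_apply] at i1 i2
      have i5 : Integrable (fun ω => (X k ω + X m ω) ^ 4 + (X k ω - X m ω) ^ 4 - 2 * X k ω ^ 4) P :=
        (i1.1.add i2.1).sub (i3.1.const_mul 2)
      rw [integral_const_mul, integral_sub i5
        (i4.1.const_mul 2), integral_sub (i1.1.fun_add i2.1) (i3.1.const_mul 2),
        integral_add i1.1 i2.1, integral_const_mul, integral_const_mul, i1.2, i2.2, i3.2, i4.2,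
        if_neg hkm]
      ring
  have hVar : Var[fun ω => ∑ k, X k ω ^ 2; P] = 2 * ∑ k, l k ^ 2 := by
    rw [variance_eq_sub hS, hES]
    have h2 : ∫ ω, (∑ k, X k ω ^ 2) ^ 2 ∂P = (∑ k, l k) ^ 2 + 2 * ∑ k, l k ^ 2 := by
      simp_rw [sq (∑ k, _), Finset.sum_mul_sum]
      have hint : ∀ k m, Integrable (fun ω => X k ω ^ 2 * X m ω ^ 2) P := fun k m =>
        (hmem k).integrable_mul (hmem m)
      rw [integral_finsetSum _ fun k _ => integrable_finsetSum _ fun m _ => hint k m]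
      simp_rw [integral_finsetSum _ fun m _ => hint _ m, hprod,
        Finset.sum_add_distrib, Finset.mul_sum]
      simp
    simp only [Pi.pow_apply]
    rw [h2]
    ring
  have h := meas_ge_le_variance_div_sq hS ht
  rwa [hES, hVar] at h

/-- Concentration of the quadratic form `yᵀ A⁻¹ y` of a centered Gaussian vector `y` around its
mean. -/
lemma measure_le_abs_quadratic_form_sub_trace_le {n : ℕ} (hn : 0 < n)
    {A B : Matrix (Fin n) (Fin n) ℝ} {c C : ℝ} (hA : A.IsHermitian) (hB : B.IsHermitian)
    (hc : 0 < c)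
    (hAl : ∀ x : Fin n → ℝ, c * ∑ i, x i ^ 2 ≤ x ⬝ᵥ A.mulVec x)
    (hBl : ∀ x : Fin n → ℝ, c * ∑ i, x i ^ 2 ≤ x ⬝ᵥ B.mulVec x)
    (hBu : ∀ x : Fin n → ℝ, x ⬝ᵥ B.mulVec x ≤ C * ∑ i, x i ^ 2)
    {y : Ω → Fin n → ℝ} (hy : Measurable y)
    (hgauss : ∀ a : Fin n → ℝ,
      P.map (fun ω => a ⬝ᵥ y ω) = gaussianReal 0 (a ⬝ᵥ B.mulVec a).toNNReal)
    {η : ℝ} (hη : 0 < η) :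
    P {ω | η * n ≤ |y ω ⬝ᵥ A⁻¹.mulVec (y ω) - (A⁻¹ * B).trace|}
      ≤ ENNReal.ofReal (2 * (C / c) ^ 2 / η ^ 2 * (1 / n)) := by
  obtain ⟨Q', Q, l, hQP, hAP, hBP⟩ :=
    (posDef_of_forall_mul_sum_sq_le hA hc hAl).exists_simultaneous_diagonalization hB
  have hl := congruence_coeff_mem_Ioc hc hAl hBl hBu hQP hAP hBP
  have hA1 : A = Q' * Matrix.diagonal (fun _ => (1 : ℝ)) * Q'ᵀ := by
    rw [Matrix.diagonal_one, Matrix.mul_one, hAP]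
  have hquad : ∀ v : Fin n → ℝ, v ⬝ᵥ A⁻¹.mulVec v = ∑ k, (Q k ⬝ᵥ v) ^ 2 := fun v => by
    rw [hA1, dotProduct_inv_congruence hQP (by simp)]
    simp
  have htr : (A⁻¹ * B).trace = ∑ k, l k := by rw [hBP, hAP, trace_inv_mul_congruence hQP]
  have hBQ : ∀ k m, Q k ⬝ᵥ B.mulVec (Q m) = if k = m then l k else 0 := fun k m => by
    rw [hBP, dotProduct_mulVec_congruence hQP]
  have hn' : (0 : ℝ) < n := by exact_mod_cast hn
  simp_rw [hquad, htr]
  refine (measure_le_abs_sum_sq_sub_le (X := fun k ω => Q k ⬝ᵥ y ω) (fun k => ?_)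
    (fun k => (hl k).1.le) (fun k => ?_) (fun k m hkm => ?_) (fun k m hkm => ?_)
    (mul_pos hη hn')).trans (ENNReal.ofReal_le_ofReal ?_)
  · simp only [dotProduct]
    fun_prop
  · rw [hgauss, hBQ, if_pos rfl]
  · simp_rw [← add_dotProduct]
    rw [hgauss, Matrix.mulVec_add, dotProduct_add, add_dotProduct, add_dotProduct, hBQ, hBQ, hBQ,
      hBQ, if_pos rfl, if_pos rfl, if_neg hkm, if_neg (Ne.symm hkm), add_zero, zero_add]
  · simp_rw [← sub_dotProduct]
    rw [hgauss, Matrix.mulVec_sub, dotProduct_sub, sub_dotProduct, sub_dotProduct, hBQ, hBQ, hBQ,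
      hBQ, if_pos rfl, if_pos rfl, if_neg hkm, if_neg (Ne.symm hkm), sub_zero, zero_sub,
      sub_neg_eq_add]
  · have hsum : ∑ k, l k ^ 2 ≤ n * (C / c) ^ 2 := by
      refine (Finset.sum_le_sum fun k _ => pow_le_pow_left₀ (hl k).1.le (hl k).2 2).trans ?_
      simp
    calc (2 * ∑ k, l k ^ 2) / (η * n) ^ 2 ≤ 2 * (n * (C / c) ^ 2) / (η * n) ^ 2 := by gcongr
      _ = 2 * (C / c) ^ 2 / η ^ 2 * (1 / n) := by field_simp

end GaussianQuadratic

/-- In dimension `d < γ`, the sum of `(1 + ‖x j - z‖) ^ (-γ)` over a `Δ`-separated family is bounded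
uniformly in the size of the family and in `z`. -/
lemma exists_sum_one_add_norm_rpow_neg_le {d : ℕ} {γ : ℝ} (hγ : (d : ℝ) < γ) {Δ : ℝ} (hΔ : 0 < Δ) :
    ∃ S : ℝ, ∀ (n : ℕ) (x : Fin n → EuclideanSpace ℝ (Fin d)),
      (∀ i j, i ≠ j → Δ ≤ ‖x i - x j‖) → ∀ z, ∑ j, (1 + ‖z - x j‖) ^ (-γ) ≤ S := by
  have hγ0 : 0 < γ := (Nat.cast_nonneg d).trans_lt hγ
  set I : ℝ := ∫ u : EuclideanSpace ℝ (Fin d), (1 + Δ / 2) ^ γ * (1 + ‖u‖) ^ (-γ)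
  have hint : Integrable fun u : EuclideanSpace ℝ (Fin d) => (1 + Δ / 2) ^ γ * (1 + ‖u‖) ^ (-γ) :=
    (integrable_one_add_norm (by simpa using hγ)).const_mul _
  set V : ℝ := volume.real (Metric.ball (0 : EuclideanSpace ℝ (Fin d)) (Δ / 2)) with hV
  have hVpos : 0 < V := ENNReal.toReal_pos
    (Metric.measure_ball_pos volume _ (half_pos hΔ)).ne' measure_ball_lt_top.ne
  refine ⟨I / V, fun n x hx z => ?_⟩
  rw [le_div_iff₀ hVpos, Finset.sum_mul]
  have hball : ∀ j, (1 + ‖z - x j‖) ^ (-γ) * V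
      ≤ ∫ u in Metric.ball (x j - z) (Δ / 2), (1 + Δ / 2) ^ γ * (1 + ‖u‖) ^ (-γ) := fun j => by
    have hVj : volume.real (Metric.ball (x j - z) (Δ / 2)) = V := by
      rw [hV, measureReal_def, measureReal_def, Measure.addHaar_ball_center]
    rw [← hVj, mul_comm, ← smul_eq_mul, ← setIntegral_const]
    refine setIntegral_mono_on (integrableOn_const measure_ball_lt_top.ne) hint.integrableOn
      measurableSet_ball fun u hu => ?_
    rw [Metric.mem_ball, dist_eq_norm] at hu
    have h1 : ‖u‖ ≤ ‖z - x j‖ + Δ / 2 := by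
      have h := norm_add_le (x j - z) (u - (x j - z))
      rw [add_sub_cancel, norm_sub_rev (x j)] at h
      linarith
    have h2 : (1 + ‖u‖) ^ γ ≤ ((1 + Δ / 2) * (1 + ‖z - x j‖)) ^ γ := by
      refine Real.rpow_le_rpow (by positivity) ?_ hγ0.le
      nlinarith [norm_nonneg (z - x j)]
    rw [Real.mul_rpow (by positivity) (by positivity)] at h2
    rw [Real.rpow_neg (by positivity), Real.rpow_neg (by positivity), ← div_eq_mul_inv,
      le_div_iff₀ (by positivity), inv_mul_le_iff₀ (by positivity), mul_comm]
    exact h2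
  refine (Finset.sum_le_sum fun j _ => hball j).trans ?_
  rw [← integral_biUnion_finset Finset.univ (fun j _ => measurableSet_ball) ?_
    (fun j _ => hint.integrableOn)]
  · exact setIntegral_le_integral hint (Eventually.of_forall fun u => by positivity)
  · intro i _ j _ hij
    refine Metric.ball_disjoint_ball ?_
    rw [dist_eq_norm, sub_sub_sub_cancel_right, add_halves]
    exact hx i j hij

section HilbertBasis

variable {H : Type*} [NormedAddCommGroup H] [InnerProductSpace ℝ H]

lemma exists_sum_one_add_norm_sub_rpow_neg_le (e : HilbertBasis ℕ ℝ H) (f : (n : ℕ) → Fin n → H)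
    {d : ℕ} {γ : ℝ} (hγ : (d : ℝ) < γ) {Δ : ℝ} (hΔ : 0 < Δ)
    (hsep : ∀ n, ∀ i j : Fin n, i ≠ j →
      Δ ≤ ‖(∑ k ∈ Finset.range d, ⟪f n i, e k⟫ • e k) - ∑ k ∈ Finset.range d, ⟪f n j, e k⟫ • e k‖) :
    ∃ S : ℝ, ∀ n, ∀ i : Fin n, ∑ j, (1 + ‖f n i - f n j‖) ^ (-γ) ≤ S := by
  obtain ⟨S, hS⟩ := exists_sum_one_add_norm_rpow_neg_le hγ hΔ
  have hγ0 : 0 < γ := (Nat.cast_nonneg d).trans_lt hγ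
  let π : H → EuclideanSpace ℝ (Fin d) := fun v => WithLp.toLp 2 fun k => ⟪v, e k⟫
  have hort : Orthonormal ℝ fun k : Fin d => e k := e.orthonormal.comp _ Fin.val_injective
  have hπsq : ∀ u v, ‖π u - π v‖ ^ 2 = ∑ k : Fin d, ⟪u - v, e k⟫ ^ 2 := fun u v => by
    rw [EuclideanSpace.norm_sq_eq]
    simp [π, inner_sub_left]
  have hπle : ∀ u v, ‖π u - π v‖ ≤ ‖u - v‖ := fun u v => by
    refine (pow_le_pow_iff_left₀ (norm_nonneg _) (norm_nonneg _) two_ne_zero).1 ?_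
    rw [hπsq]
    simpa [real_inner_comm] using hort.sum_inner_products_le (x := u - v) (s := Finset.univ)
  have hπeq : ∀ u v, ‖π u - π v‖ = ‖(∑ k ∈ Finset.range d, ⟪u, e k⟫ • e k)
      - ∑ k ∈ Finset.range d, ⟪v, e k⟫ • e k‖ := fun u v => by
    have h : ‖(∑ k ∈ Finset.range d, ⟪u, e k⟫ • e k)
        - ∑ k ∈ Finset.range d, ⟪v, e k⟫ • e k‖ ^ 2 = ∑ k : Fin d, ⟪u - v, e k⟫ ^ 2 := by
      rw [← Finset.sum_sub_distrib, Finset.sum_range]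
      simp_rw [← sub_smul, ← inner_sub_left]
      rw [← real_inner_self_eq_norm_sq, hort.inner_sum]
      simp [sq]
    rw [← hπsq] at h
    exact ((pow_left_inj₀ (norm_nonneg _) (norm_nonneg _) two_ne_zero).1 h).symm
  refine ⟨S, fun n i => le_trans (Finset.sum_le_sum fun j _ => ?_) (hS n (fun j => π (f n j))
    (fun i j hij => (hsep n i j hij).trans (hπeq _ _).ge) (π (f n i)))⟩
  exact Real.rpow_le_rpow_of_nonpos (by positivity) (by linarith [hπle (f n i) (f n j)])
    (by linarith)

/-- Bounded sets whose coordinates are dominated by a square-summable sequence are totally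
bounded. -/
lemma totallyBounded_of_coord_le (e : HilbertBasis ℕ ℝ H) (r : ℝ) {J : ℕ} {t : ℕ → ℝ}
    (ht : Summable fun j => t (J + j) ^ 2) :
    TotallyBounded {g : H | ‖g‖ ≤ r ∧ ∀ j, J ≤ j → |⟪g, e j⟫| ≤ t j} := by
  rw [Metric.totallyBounded_iff]
  intro ε hε
  obtain ⟨m₀, hm₀⟩ : ∃ m₀, ∑' k, t (J + (k + m₀)) ^ 2 < (ε / 2) ^ 2 :=
    ((tendsto_sum_nat_add fun j => t (J + j) ^ 2).eventually_lt_const (by positivity)).exists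
  let L : (Fin (J + m₀) → ℝ) → H := fun v => ∑ k, v k • e k
  have hL : Continuous L := by fun_prop
  obtain ⟨T, hT, hTcov⟩ := Metric.totallyBounded_iff.1
    ((isCompact_closedBall (0 : Fin (J + m₀) → ℝ) (max r 0)).image hL).totallyBounded (ε / 2)
    (half_pos hε)
  refine ⟨T, hT, fun g hg => ?_⟩
  set v : Fin (J + m₀) → ℝ := fun k => ⟪g, e k⟫ with hv
  have hvmem : v ∈ Metric.closedBall (0 : Fin (J + m₀) → ℝ) (max r 0) := by
    rw [mem_closedBall_zero_iff, pi_norm_le_iff_of_nonneg (le_max_right _ _)]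
    intro k
    refine le_trans ?_ (hg.1.trans (le_max_left _ _))
    simpa [hv, e.orthonormal.1] using norm_inner_le_norm (𝕜 := ℝ) g (e k)
  obtain ⟨z, hz, hzL⟩ := Set.mem_iUnion₂.1 (hTcov (Set.mem_image_of_mem L hvmem))
  refine Set.mem_iUnion₂.2 ⟨z, hz, ?_⟩
  have hcoord : ∀ j, ⟪g - L v, e j⟫ = if j < J + m₀ then 0 else ⟪g, e j⟫ := fun j => by
    have hLj : ⟪L v, e j⟫ = if j < J + m₀ then ⟪g, e j⟫ else 0 := by
      simp only [L, sum_inner, inner_smul_left, hv, orthonormal_iff_ite.1 e.orthonormal]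
      split_ifs with hj
      · rw [Finset.sum_eq_single ⟨j, hj⟩] <;> simp +contextual [Fin.ext_iff]
      · exact Finset.sum_eq_zero fun k _ => by simp [(k.2.trans_le (not_lt.1 hj)).ne]
    rw [inner_sub_left, hLj]
    split_ifs <;> simp
  have hsum : HasSum (fun j => ⟪g - L v, e j⟫ ^ 2) (‖g - L v‖ ^ 2) := by
    have h := e.hasSum_inner_mul_inner (g - L v) (g - L v)
    rw [real_inner_self_eq_norm_sq] at h
    simpa [sq, real_inner_comm] using h
  have hnorm : ‖g - L v‖ ^ 2 < (ε / 2) ^ 2 := by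
    rw [← hsum.tsum_eq, ← hsum.summable.sum_add_tsum_nat_add (J + m₀), Finset.sum_eq_zero, zero_add]
    · refine lt_of_le_of_lt (Summable.tsum_le_tsum (fun k => ?_)
        ((summable_nat_add_iff (J + m₀)).2 hsum.summable) ?_) hm₀
      · rw [hcoord, if_neg (by omega), show J + (k + m₀) = k + (J + m₀) by ring]
        exact sq_le_sq' (abs_le.1 (hg.2 _ (by omega))).1 (abs_le.1 (hg.2 _ (by omega))).2
      · exact (summable_nat_add_iff (f := fun j => t (J + j) ^ 2) m₀).2 ht
    · intro j hj
      rw [hcoord, if_pos (Finset.mem_range.1 hj), sq, zero_mul]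
  have h1 : ‖g - L v‖ < ε / 2 := lt_of_pow_lt_pow_left₀ 2 (by positivity) hnorm
  rw [Metric.mem_ball] at hzL ⊢
  calc dist g z ≤ dist g (L v) + dist (L v) z := dist_triangle _ _ _
    _ < ε / 2 + ε / 2 := add_lt_add (by rwa [dist_eq_norm]) hzL
    _ = ε := add_halves ε

end HilbertBasis

lemma one_div_one_add_rpow_le {t γ : ℝ} (ht : 0 ≤ t) (hγ : 0 ≤ γ) :
    1 / (1 + t ^ γ) ≤ 2 ^ γ * (1 + t) ^ (-γ) := by
  have h0 : 0 ≤ t ^ γ := Real.rpow_nonneg ht γ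
  have h : (1 + t) ^ γ ≤ 2 ^ γ * (1 + t ^ γ) := by
    rcases le_total t 1 with h1 | h1
    · calc (1 + t) ^ γ ≤ 2 ^ γ := Real.rpow_le_rpow (by positivity) (by linarith) hγ
        _ ≤ 2 ^ γ * (1 + t ^ γ) := le_mul_of_one_le_right (by positivity) (by linarith)
    · calc (1 + t) ^ γ ≤ (2 * t) ^ γ := Real.rpow_le_rpow (by positivity) (by linarith) hγ
        _ = 2 ^ γ * t ^ γ := Real.mul_rpow (by norm_num) ht
        _ ≤ 2 ^ γ * (1 + t ^ γ) := by gcongr; linarith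
  rw [Real.rpow_neg (by positivity), ← div_eq_mul_inv, div_le_div_iff₀ (by positivity)
    (by positivity), one_mul]
  exact h

section Kernel

variable {H : Type*} [NormedAddCommGroup H] {p : ℕ}
  {Θ : Set (EuclideanSpace ℝ (Fin p))} {K : EuclideanSpace ℝ (Fin p) → H → ℝ}

lemma abs_kernel_le {γ C : ℝ} (hγ : 0 ≤ γ) (hK : ∀ θ ∈ Θ, ∀ g : H, |K θ g| ≤ C / (1 + ‖g‖ ^ γ))
    {θ : EuclideanSpace ℝ (Fin p)} (hθ : θ ∈ Θ) (g : H) :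
    |K θ g| ≤ max C 0 * 2 ^ γ * (1 + ‖g‖) ^ (-γ) := by
  have h0 : 0 ≤ ‖g‖ ^ γ := Real.rpow_nonneg (norm_nonneg g) γ
  calc |K θ g| ≤ C / (1 + ‖g‖ ^ γ) := hK θ hθ g
    _ ≤ max C 0 * (1 / (1 + ‖g‖ ^ γ)) := by
        rw [mul_one_div]
        gcongr
        exact le_max_left _ _
    _ ≤ max C 0 * (2 ^ γ * (1 + ‖g‖) ^ (-γ)) :=
        mul_le_mul_of_nonneg_left (one_div_one_add_rpow_le (norm_nonneg g) hγ) (le_max_right _ _)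
    _ = _ := (mul_assoc _ _ _).symm

/-- Uniform decaying modulus of continuity of the covariance functions in the inputs. -/
lemma exists_abs_kernel_sub_le_of_norm_sub_le {γ ρ C : ℝ} (hγ : 0 ≤ γ) (hρ : 0 < ρ)
    (hK : ∀ θ ∈ Θ, ∀ a b : H, 0 < ‖a - b‖ → ‖a - b‖ ≤ ρ →
      |K θ a - K θ b| ≤ C * ‖a - b‖ / (1 + min ‖a‖ ‖b‖ ^ γ)) {ε : ℝ} (hε : 0 < ε) :
    ∃ δ > 0, ∀ θ ∈ Θ, ∀ a b : H, ‖a - b‖ ≤ δ → |K θ a - K θ b| ≤ ε * (1 + ‖b‖) ^ (-γ) := by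
  set D : ℝ := (max C 0 + 1) * (2 ^ γ * 2 ^ γ) with hD
  have hD0 : 0 < D := by positivity
  refine ⟨min ρ (min (1 / 2) (ε / D)), by positivity, fun θ hθ a b hab => ?_⟩
  obtain ⟨h1, h23⟩ := le_min_iff.1 hab
  obtain ⟨h2, h3⟩ := le_min_iff.1 h23
  rcases (norm_nonneg (a - b)).eq_or_lt with h0 | h0
  · rw [sub_eq_zero.1 (norm_eq_zero.1 h0.symm), sub_self, abs_zero]
    positivity
  have hm0 : 0 ≤ min ‖a‖ ‖b‖ := le_min (norm_nonneg _) (norm_nonneg _)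
  have hm : (1 + ‖b‖) / 2 ≤ 1 + min ‖a‖ ‖b‖ := by
    have h := norm_sub_norm_le b a
    rw [norm_sub_rev] at h
    rcases min_choice ‖a‖ ‖b‖ with h' | h' <;> rw [h'] <;> linarith [norm_nonneg b]
  have hm' : (1 + min ‖a‖ ‖b‖) ^ (-γ) ≤ 2 ^ γ * (1 + ‖b‖) ^ (-γ) := by
    calc (1 + min ‖a‖ ‖b‖) ^ (-γ) ≤ ((1 + ‖b‖) / 2) ^ (-γ) :=
          Real.rpow_le_rpow_of_nonpos (by positivity) hm (by linarith)
      _ = 2 ^ γ * (1 + ‖b‖) ^ (-γ) := by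
          rw [Real.div_rpow (by positivity) (by norm_num), Real.rpow_neg (by norm_num : (0:ℝ) ≤ 2),
            div_inv_eq_mul, mul_comm]
  have hmγ : 0 ≤ min ‖a‖ ‖b‖ ^ γ := Real.rpow_nonneg hm0 γ
  calc |K θ a - K θ b| ≤ C * ‖a - b‖ / (1 + min ‖a‖ ‖b‖ ^ γ) := hK θ hθ a b h0 h1
    _ ≤ (max C 0 + 1) * (ε / D) * (1 / (1 + min ‖a‖ ‖b‖ ^ γ)) := by
        rw [mul_one_div]
        gcongr
        linarith [le_max_left C 0]
    _ ≤ (max C 0 + 1) * (ε / D) * (2 ^ γ * (2 ^ γ * (1 + ‖b‖) ^ (-γ))) := by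
        gcongr
        exact (one_div_one_add_rpow_le hm0 hγ).trans (by gcongr)
    _ = ε * (1 + ‖b‖) ^ (-γ) := by
        rw [hD]
        field_simp

lemma exists_abs_kernel_sub_le_of_totallyBounded {ρ C γ : ℝ} (hγ : 0 ≤ γ) (hρ : 0 < ρ)
    (hcont : ∀ g : H, ContinuousOn (fun θ => K θ g) Θ)
    (hK : ∀ θ ∈ Θ, ∀ a b : H, 0 < ‖a - b‖ → ‖a - b‖ ≤ ρ →
      |K θ a - K θ b| ≤ C * ‖a - b‖ / (1 + min ‖a‖ ‖b‖ ^ γ))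
    {T : Set H} (hT : TotallyBounded T) {θ₁ : EuclideanSpace ℝ (Fin p)} (hθ₁ : θ₁ ∈ Θ)
    {ε : ℝ} (hε : 0 < ε) :
    ∀ᶠ θ in 𝓝[Θ] θ₁, ∀ g ∈ T, |K θ g - K θ₁ g| ≤ ε := by
  obtain ⟨δ, hδ, hδK⟩ := exists_abs_kernel_sub_le_of_norm_sub_le hγ hρ hK
    (show 0 < ε / 3 by positivity)
  have hδK' : ∀ θ ∈ Θ, ∀ a b : H, ‖a - b‖ ≤ δ → |K θ a - K θ b| ≤ ε / 3 := fun θ hθ a b hab =>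
    (hδK θ hθ a b hab).trans (mul_le_of_le_one_right (by positivity)
      (Real.rpow_le_one_of_one_le_of_nonpos (by linarith [norm_nonneg b]) (by linarith)))
  obtain ⟨Z, hZ, hZcov⟩ := Metric.totallyBounded_iff.1 hT δ hδ
  have hev : ∀ᶠ θ in 𝓝[Θ] θ₁, ∀ z ∈ Z, |K θ z - K θ₁ z| ≤ ε / 3 := by
    rw [Set.Finite.eventually_all hZ]
    intro z _
    filter_upwards [Metric.tendsto_nhds.1 (hcont z θ₁ hθ₁) (ε / 3) (by positivity)] with θ hθ
    exact hθ.le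
  filter_upwards [hev, self_mem_nhdsWithin] with θ hθ hθΘ g hg
  obtain ⟨z, hz, hgz⟩ := Set.mem_iUnion₂.1 (hZcov hg)
  rw [Metric.mem_ball, dist_eq_norm] at hgz
  have h1 := abs_le.1 (hδK' θ hθΘ g z hgz.le)
  have h2 := abs_le.1 (hδK' θ₁ hθ₁ g z hgz.le)
  have h3 := abs_le.1 (hθ z hz)
  rw [abs_le]
  constructor <;> linarith

/-- Continuity of the covariance functions in the parameter, with a modulus that decays in the
input, along a set with totally bounded bounded parts. -/
lemma eventually_abs_kernel_sub_le {ρ C C₀ γ γ' : ℝ} (hγ' : 0 ≤ γ') (hγ : γ' < γ) (hρ : 0 < ρ)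
    (hcont : ∀ g : H, ContinuousOn (fun θ => K θ g) Θ)
    (hdecay : ∀ θ ∈ Θ, ∀ g : H, |K θ g| ≤ C₀ / (1 + ‖g‖ ^ γ))
    (hK : ∀ θ ∈ Θ, ∀ a b : H, 0 < ‖a - b‖ → ‖a - b‖ ≤ ρ →
      |K θ a - K θ b| ≤ C * ‖a - b‖ / (1 + min ‖a‖ ‖b‖ ^ γ))
    {T : Set H} (hT : ∀ r : ℝ, TotallyBounded {g ∈ T | ‖g‖ ≤ r})
    {θ₁ : EuclideanSpace ℝ (Fin p)} (hθ₁ : θ₁ ∈ Θ) {ε : ℝ} (hε : 0 < ε) :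
    ∀ᶠ θ in 𝓝[Θ] θ₁, ∀ g ∈ T, |K θ g - K θ₁ g| ≤ ε * (1 + ‖g‖) ^ (-γ') := by
  have hγ0 : 0 ≤ γ := hγ'.trans hγ.le
  set D : ℝ := max C₀ 0 * 2 ^ γ with hD
  obtain ⟨r, hr0, hr⟩ : ∃ r : ℝ, 0 ≤ r ∧ 2 * D * (1 + r) ^ (-(γ - γ')) ≤ ε := by
    have h1 : Tendsto (fun r : ℝ => 2 * D * (1 + r) ^ (-(γ - γ'))) atTop (𝓝 (2 * D * 0)) :=
      ((tendsto_rpow_neg_atTop (sub_pos.2 hγ)).comp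
        (tendsto_atTop_add_const_left _ _ tendsto_id)).const_mul _
    rw [mul_zero] at h1
    obtain ⟨r, h2, h3⟩ := ((h1.eventually_lt_const hε).and (eventually_ge_atTop 0)).exists
    exact ⟨r, h3, h2.le⟩
  filter_upwards [exists_abs_kernel_sub_le_of_totallyBounded hγ0 hρ hcont hK (hT r) hθ₁
    (show 0 < ε * (1 + r) ^ (-γ') by positivity), self_mem_nhdsWithin] with θ hθ hθΘ g hg
  rcases le_total ‖g‖ r with hgr | hgr
  · refine (hθ g ⟨hg, hgr⟩).trans (mul_le_mul_of_nonneg_left ?_ hε.le)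
    exact Real.rpow_le_rpow_of_nonpos (by positivity) (by linarith) (by linarith)
  · have h1 := abs_kernel_le hγ0 hdecay hθΘ g
    have h2 := abs_kernel_le hγ0 hdecay hθ₁ g
    calc |K θ g - K θ₁ g| ≤ |K θ g| + |K θ₁ g| := abs_sub _ _
      _ ≤ 2 * D * (1 + ‖g‖) ^ (-γ) := by linarith
      _ = 2 * D * (1 + ‖g‖) ^ (-(γ - γ')) * (1 + ‖g‖) ^ (-γ') := by
          rw [mul_assoc (2 * D), ← Real.rpow_add (by positivity)]
          congr 2
          ring
      _ ≤ 2 * D * (1 + r) ^ (-(γ - γ')) * (1 + ‖g‖) ^ (-γ') := by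
          gcongr 2 * D * ?_ * _
          exact Real.rpow_le_rpow_of_nonpos (by positivity) (by linarith) (by linarith)
      _ ≤ ε * (1 + ‖g‖) ^ (-γ') := by gcongr

end Kernel

/-- If the perturbed matrices are close to `A` and `B` and the quadratic forms concentrate, the
perturbed Gaussian likelihoods are ordered according to the Kullback–Leibler gap. -/
lemma likelihood_lt_of_klDiv_gap {n : ℕ} (hn : 0 < n) {A A' B B' : Matrix (Fin n) (Fin n) ℝ}
    (hA : A.PosDef) (hB : B.PosDef) (hA' : A'.IsHermitian) (hB' : B'.IsHermitian)
    {τ η b g : ℝ} (hτ0 : 0 ≤ τ) (hτ : τ ≤ 1 / 2) (hη : η ≤ 1)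
    (hAA' : ∀ x, |x ⬝ᵥ A'.mulVec x - x ⬝ᵥ A.mulVec x| ≤ τ * (x ⬝ᵥ A.mulVec x))
    (hBB' : ∀ x, |x ⬝ᵥ B'.mulVec x - x ⬝ᵥ B.mulVec x| ≤ τ * (x ⬝ᵥ B.mulVec x))
    (htr : (A⁻¹ * B).trace ≤ b * n)
    (hgap : g * n ≤ Real.log A.det + (A⁻¹ * B).trace - (Real.log B.det + n))
    (hsmall : 2 * η + 2 * τ * (b + 5) < g) {v : Fin n → ℝ}
    (hvA : |v ⬝ᵥ A⁻¹.mulVec v - (A⁻¹ * B).trace| < η * n)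
    (hvB : |v ⬝ᵥ B⁻¹.mulVec v - (B⁻¹ * B).trace| < η * n) :
    (1 / (n : ℝ)) * Real.log B'.det + (1 / (n : ℝ)) * (v ⬝ᵥ B'⁻¹.mulVec v)
      < (1 / (n : ℝ)) * Real.log A'.det + (1 / (n : ℝ)) * (v ⬝ᵥ A'⁻¹.mulVec v) := by
  have hn' : (0 : ℝ) < n := Nat.cast_pos.2 hn
  rw [Matrix.nonsing_inv_mul _ (Matrix.isUnit_iff_isUnit_det _ |>.1 hB.isUnit), Matrix.trace_one,
    Fintype.card_fin] at hvB
  obtain ⟨hdA, hqA⟩ := likelihood_terms_perturbation hA hA' hτ hAA'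
  obtain ⟨hdB, hqB⟩ := likelihood_terms_perturbation hB hB' hτ hBB'
  rw [← mul_add, ← mul_add]
  refine mul_lt_mul_of_pos_left ?_ (by positivity)
  have h1 := abs_le.1 hdA
  have h2 := abs_le.1 hdB
  have h3 := abs_le.1 (hqA v)
  have h4 := abs_le.1 (hqB v)
  have h5 := abs_lt.1 hvA
  have h6 := abs_lt.1 hvB
  have hηn : η * n ≤ n := mul_le_of_le_one_left hn'.le hη
  have h7 : 2 * τ * (v ⬝ᵥ A⁻¹.mulVec v) ≤ 2 * τ * ((b + 1) * n) :=
    mul_le_mul_of_nonneg_left (by linarith) (by positivity)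
  have h8 : 2 * τ * (v ⬝ᵥ B⁻¹.mulVec v) ≤ 2 * τ * (2 * n) :=
    mul_le_mul_of_nonneg_left (by linarith) (by positivity)
  have h9 := mul_lt_mul_of_pos_right hsmall hn'
  nlinarith

section CovMatrix

variable {H : Type*} [NormedAddCommGroup H] [InnerProductSpace ℝ H] {p : ℕ}
  {Θ : Set (EuclideanSpace ℝ (Fin p))} {K : EuclideanSpace ℝ (Fin p) → H → ℝ}
  {θ : EuclideanSpace ℝ (Fin p)}

lemma covMatrix_apply_comm (hstat : ∀ θ ∈ Θ, ∀ g : H, K θ (-g) = K θ g)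
    (f : (n : ℕ) → Fin n → H) (hθ : θ ∈ Θ) (n : ℕ) (i j : Fin n) :
    covMatrix K f n θ i j = covMatrix K f n θ j i := by
  simp only [covMatrix, Matrix.of_apply]
  rw [← hstat θ hθ, neg_sub]

lemma covMatrix_isHermitian (hstat : ∀ θ ∈ Θ, ∀ g : H, K θ (-g) = K θ g)
    (f : (n : ℕ) → Fin n → H) (hθ : θ ∈ Θ) (n : ℕ) : (covMatrix K f n θ).IsHermitian :=
  Matrix.IsHermitian.ext fun i j => covMatrix_apply_comm hstat f hθ n j i

lemma abs_dotProduct_covMatrix_sub_le (hstat : ∀ θ ∈ Θ, ∀ g : H, K θ (-g) = K θ g)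
    (f f' : (n : ℕ) → Fin n → H) {θ' : EuclideanSpace ℝ (Fin p)} (hθ : θ ∈ Θ) (hθ' : θ' ∈ Θ)
    {n : ℕ} {γ ε S : ℝ} (hε : 0 ≤ ε) (hS : ∀ i, ∑ j, (1 + ‖f n i - f n j‖) ^ (-γ) ≤ S)
    (h : ∀ i j, |K θ' (f' n i - f' n j) - K θ (f n i - f n j)|
      ≤ ε * (1 + ‖f n i - f n j‖) ^ (-γ)) (x : Fin n → ℝ) :
    |x ⬝ᵥ (covMatrix K f' n θ').mulVec x - x ⬝ᵥ (covMatrix K f n θ).mulVec x|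
      ≤ ε * S * ∑ i, x i ^ 2 := by
  rw [← dotProduct_sub, ← Matrix.sub_mulVec]
  refine abs_dotProduct_mulVec_le_of_row_sum_le (fun i j => ?_) (fun i => ?_) x
  · rw [Matrix.sub_apply, Matrix.sub_apply, covMatrix_apply_comm hstat f hθ,
      covMatrix_apply_comm hstat f' hθ']
  · refine le_trans (Finset.sum_le_sum fun j _ => h i j) ?_
    rw [← Finset.mul_sum]
    exact mul_le_mul_of_nonneg_left (hS i) hε

lemma dotProduct_covMatrix_le (hstat : ∀ θ ∈ Θ, ∀ g : H, K θ (-g) = K θ g)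
    {γ C S : ℝ} (hγ : 0 ≤ γ) (hK : ∀ θ ∈ Θ, ∀ g : H, |K θ g| ≤ C / (1 + ‖g‖ ^ γ))
    (f : (n : ℕ) → Fin n → H) (hθ : θ ∈ Θ) {n : ℕ}
    (hS : ∀ i, ∑ j, (1 + ‖f n i - f n j‖) ^ (-γ) ≤ S) (x : Fin n → ℝ) :
    x ⬝ᵥ (covMatrix K f n θ).mulVec x ≤ max C 0 * 2 ^ γ * S * ∑ i, x i ^ 2 := by
  refine (le_abs_self _).trans (abs_dotProduct_mulVec_le_of_row_sum_le
    (covMatrix_apply_comm hstat f hθ n) (fun i => ?_) x)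
  refine le_trans (Finset.sum_le_sum fun j _ => abs_kernel_le hγ hK hθ _) ?_
  rw [← Finset.mul_sum]
  exact mul_le_mul_of_nonneg_left (hS i) (by positivity)

end CovMatrix

/-- A finite union bound: if each of finitely many sequences of events has vanishing probability,
so does any sequence of events eventually contained in their union. -/
lemma tendsto_measure_zero_of_subset_biUnion {Ω ι : Type*} [MeasurableSpace Ω] (P : Measure Ω)
    (t : Finset ι) {E : ℕ → Set Ω} {F : ι → ℕ → Set Ω}
    (hF : ∀ i ∈ t, Tendsto (fun n => P (F i n)) atTop (𝓝 0))
    (hE : ∀ᶠ n in atTop, E n ⊆ ⋃ i ∈ t, F i n) : Tendsto (fun n => P (E n)) atTop (𝓝 0) := by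
  refine tendsto_of_tendsto_of_tendsto_of_le_of_le' tendsto_const_nhds
    (h := fun n => ∑ i ∈ t, P (F i n)) ?_ (Eventually.of_forall fun n => zero_le) ?_
  · simpa using tendsto_finsetSum t hF
  · filter_upwards [hE] with n hn
    exact (measure_mono hn).trans (measure_biUnion_finset_le t fun i => F i n)

/-- Theorem 3: consistency of the maximum likelihood estimator computed from approximated
functional inputs, under Conditions 1, 2, 3, 4, 5, 7, 9, 10 and 11. -/
theorem mle_consistent_noisy_inputs
    {H : Type*} [NormedAddCommGroup H] [InnerProductSpace ℝ H] [CompleteSpace H]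
    (e : HilbertBasis ℕ ℝ H)
    (f : (n : ℕ) → Fin n → H)
    {p : ℕ} (hp : 1 ≤ p)
    (Θ : Set (EuclideanSpace ℝ (Fin p))) (hΘ : IsCompact Θ)
    (θ₀ : EuclideanSpace ℝ (Fin p)) (hθ₀ : θ₀ ∈ interior Θ)
    (K : EuclideanSpace ℝ (Fin p) → H → ℝ)
    (hstat : ∀ θ ∈ Θ, ∀ g : H, K θ (-g) = K θ g)
    -- Condition 1
    (Δ : ℝ) (hΔ : 0 < Δ)
    (hC1 : ∀ n, ∀ i j : Fin n, i ≠ j → 2 * Δ ≤ ‖f n i - f n j‖)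
    -- Condition 2
    (J₀ : ℕ) (s : ℕ → ℝ) (hs0 : ∀ j, J₀ ≤ j → 0 ≤ s j)
    (hssum : Summable fun j : ℕ => s (J₀ + j) ^ 2)
    (hC2 : ∀ n, ∀ i : Fin n, ∀ j, J₀ ≤ j → |(⟪f n i, e j⟫)| ≤ s j)
    -- the integer d₀ given by Lemma 1
    (d₀ : ℕ) (hd₀J : J₀ ≤ d₀)
    (hd₀tail : ∑' k : ℕ, s (d₀ + 1 + k) ^ 2 < Δ ^ 2 / 16)
    (hd₀sep : ∀ n, ∀ i j : Fin n, i ≠ j →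
      Δ ≤ ‖(∑ k ∈ Finset.range d₀, ⟪f n i, e k⟫ • e k)
            - ∑ k ∈ Finset.range d₀, ⟪f n j, e k⟫ • e k‖)
    -- Condition 3
    (γ₀ : ℝ) (hγ₀ : (d₀ : ℝ) < γ₀) (C₀ : ℝ)
    (hC3 : ∀ θ ∈ Θ, ∀ g : H, |K θ g| ≤ C₀ / (1 + ‖g‖ ^ γ₀))
    -- Condition 4
    (c : ℝ) (hc : 0 < c)
    (hC4 : ∀ n, ∀ θ ∈ Θ, ∀ x : Fin n → ℝ,
      c * ∑ i, x i ^ 2 ≤ x ⬝ᵥ (covMatrix K f n θ).mulVec x)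
    -- Condition 5
    (hC5 : ∀ α > (0 : ℝ), ∃ β > (0 : ℝ), ∀ᶠ n : ℕ in atTop, ∀ θ ∈ Θ, α ≤ dist θ θ₀ →
      β ≤ (1 / (n : ℝ)) * ∑ i : Fin n, ∑ j : Fin n,
        (K θ (f n i - f n j) - K θ₀ (f n i - f n j)) ^ 2)
    -- Condition 7
    (hdiff : ∀ g : H, ContDiffOn ℝ 1 (fun θ => K θ g) Θ)
    (γ₁ : ℝ) (hγ₁ : (d₀ : ℝ) < γ₁) (C₁ : ℝ)
    (hC7 : ∀ θ ∈ Θ, ∀ i : Fin p, ∀ g : H,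
      |fderivWithin ℝ (fun t => K t g) Θ θ (EuclideanSpace.single i 1)| ≤ C₁ / (1 + ‖g‖ ^ γ₁))
    -- Condition 9: the approximated inputs f_i^N and the approximation orders N_n
    (fapp : (n : ℕ) → ℕ → Fin n → H) (N : ℕ → ℕ)
    (hC9 : ∀ ε > (0 : ℝ), ∀ᶠ n : ℕ in atTop, ∀ i : Fin n, ‖f n i - fapp n (N n) i‖ < ε)
    -- Condition 10
    (ρ₀ : ℝ) (hρ₀ : 0 < ρ₀) (C₁₀ : ℝ)
    (hC10 : ∀ θ ∈ Θ, ∀ a b : H, 0 < ‖a - b‖ → ‖a - b‖ ≤ ρ₀ →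
      |K θ a - K θ b| ≤ C₁₀ * ‖a - b‖ / (1 + min ‖a‖ ‖b‖ ^ γ₀))
    -- Condition 11
    (ρ₁ : ℝ) (hρ₁ : 0 < ρ₁) (C₁₁ : ℝ)
    (hC11 : ∀ θ ∈ Θ, ∀ i : Fin p, ∀ a b : H, 0 < ‖a - b‖ → ‖a - b‖ ≤ ρ₁ →
      |fderivWithin ℝ (fun t => K t a) Θ θ (EuclideanSpace.single i 1)
        - fderivWithin ℝ (fun t => K t b) Θ θ (EuclideanSpace.single i 1)|
        ≤ C₁₁ * ‖a - b‖ / (1 + min ‖a‖ ‖b‖ ^ γ₁))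
    -- the probability space and the Gaussian observations y ~ N(0, R_{θ₀})
    {Ω : Type*} [MeasurableSpace Ω] (P : Measure Ω) [IsProbabilityMeasure P]
    (y : (n : ℕ) → Ω → (Fin n → ℝ)) (hy : ∀ n, Measurable (y n))
    (hgauss : ∀ n, ∀ a : Fin n → ℝ,
      P.map (fun ω => a ⬝ᵥ y n ω)
        = gaussianReal 0 (Real.toNNReal (a ⬝ᵥ (covMatrix K f n θ₀).mulVec a)))
    -- the maximum likelihood estimator computed from the approximated inputs f_i^{N_n}
    (θhat : (n : ℕ) → Ω → EuclideanSpace ℝ (Fin p))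
    (hmeas : ∀ n, Measurable (θhat n))
    (hmem : ∀ n ω, θhat n ω ∈ Θ)
    (hmin : ∀ n ω, ∀ θ ∈ Θ,
      negLogLik K (fun m i => fapp m (N m) i) y n (θhat n ω) ω
        ≤ negLogLik K (fun m i => fapp m (N m) i) y n θ ω) :
    -- conclusion: θ̂_{n,N_n} → θ₀ in probability
    ∀ ε > (0 : ℝ),
      Tendsto (fun n => P {ω | ε < dist (θhat n ω) θ₀}) atTop (𝓝 0) := by
  intro ε hε
  have hγ0 : 0 < γ₀ := (Nat.cast_nonneg d₀).trans_lt hγ₀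
  have hθ₀Θ : θ₀ ∈ Θ := interior_subset hθ₀
  obtain ⟨γ', hdγ', hγ'⟩ := exists_between hγ₀
  have hγ'0 : 0 < γ' := (Nat.cast_nonneg d₀).trans_lt hdγ'
  obtain ⟨S, hS1, hS⟩ : ∃ S : ℝ, 1 ≤ S ∧
      ∀ n, ∀ i : Fin n, ∑ j, (1 + ‖f n i - f n j‖) ^ (-γ₀) ≤ S :=
    (exists_sum_one_add_norm_sub_rpow_neg_le e f hγ₀ hΔ hd₀sep).imp' (max 1) fun S hS =>
      ⟨le_max_left _ _, fun n i => (hS n i).trans (le_max_right _ _)⟩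
  obtain ⟨S', hS1', hS'⟩ : ∃ S : ℝ, 1 ≤ S ∧
      ∀ n, ∀ i : Fin n, ∑ j, (1 + ‖f n i - f n j‖) ^ (-γ') ≤ S :=
    (exists_sum_one_add_norm_sub_rpow_neg_le e f hdγ' hΔ hd₀sep).imp' (max 1) fun S hS =>
      ⟨le_max_left _ _, fun n i => (hS n i).trans (le_max_right _ _)⟩
  obtain ⟨C, hcC, hCu⟩ : ∃ C : ℝ, c ≤ C ∧ ∀ n, ∀ θ ∈ Θ, ∀ x : Fin n → ℝ,
      x ⬝ᵥ (covMatrix K f n θ).mulVec x ≤ C * ∑ i, x i ^ 2 :=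
    ⟨max c (max C₀ 0 * 2 ^ γ₀ * S), le_max_left _ _, fun n θ hθ x =>
      (dotProduct_covMatrix_le hstat hγ0.le hC3 f hθ (hS n) x).trans (by
        gcongr
        exact le_max_right _ _)⟩
  have hC : 0 < C := hc.trans_le hcC
  have hherm : ∀ n, ∀ θ ∈ Θ, (covMatrix K f n θ).IsHermitian := fun n θ hθ =>
    covMatrix_isHermitian hstat f hθ n
  have hpos : ∀ n, ∀ θ ∈ Θ, (covMatrix K f n θ).PosDef := fun n θ hθ =>
    posDef_of_forall_mul_sum_sq_le (hherm n θ hθ) hc (hC4 n θ hθ)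
  set b := C / c
  have hb : 0 < b := by positivity
  obtain ⟨β, hβ, hβgap⟩ := hC5 ε hε
  set g : ℝ := β / (C ^ 2 * (2 * (b + 1))) with hg
  have hg0 : 0 < g := by positivity
  set η : ℝ := min 1 (g / 8)
  have hη : 0 < η := by positivity
  set τ : ℝ := min (1 / 2) (g / (8 * (b + 5)))
  have hτ : 0 < τ := by positivity
  have hsmall : 2 * η + 2 * τ * (b + 5) < g := by
    have h1 : η ≤ g / 8 := min_le_right _ _
    have h2 : τ * (b + 5) ≤ g / 8 := by
      have h3 : τ ≤ g / (8 * (b + 5)) := min_le_right _ _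
      rw [le_div_iff₀ (by positivity)] at h3
      linarith
    linarith
  have hnoise : ∀ᶠ n in atTop, ∀ θ ∈ Θ, ∀ x : Fin n → ℝ,
      |x ⬝ᵥ (covMatrix K (fun m i => fapp m (N m) i) n θ).mulVec x
        - x ⬝ᵥ (covMatrix K f n θ).mulVec x| ≤ c * τ / 2 * ∑ i, x i ^ 2 := by
    obtain ⟨δ, hδ, hδK⟩ := exists_abs_kernel_sub_le_of_norm_sub_le hγ0.le hρ₀ hC10
      (show 0 < c * τ / 2 / S by positivity)
    filter_upwards [hC9 (δ / 2) (half_pos hδ)] with n hn θ hθ x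
    have h := abs_dotProduct_covMatrix_sub_le hstat f (fun m i => fapp m (N m) i) hθ hθ
      (by positivity) (hS n) (fun i j => hδK θ hθ _ _ ?_) x
    · rwa [div_mul_cancel₀ _ (by positivity)] at h
    · rw [sub_sub_sub_comm]
      refine (norm_sub_le _ _).trans ?_
      rw [norm_sub_rev, norm_sub_rev (fapp n (N n) j)]
      linarith [hn i, hn j]
  set T : Set H := {g | ∃ n, ∃ i j : Fin n, g = f n i - f n j} with hTdef
  have hT : ∀ r : ℝ, TotallyBounded {g ∈ T | ‖g‖ ≤ r} := fun r => by
    refine (totallyBounded_of_coord_le e r (J := J₀) (t := fun j => 2 * s j) ?_).subset ?_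
    · simpa only [mul_pow] using hssum.mul_left (2 ^ 2)
    · rintro _ ⟨⟨n, i, j, rfl⟩, hr⟩
      refine ⟨hr, fun k hk => ?_⟩
      rw [inner_sub_left]
      exact (abs_sub _ _).trans (by linarith [hC2 n i k hk, hC2 n j k hk])
  have hloc : ∀ θ₁ ∈ Θ, ∀ᶠ θ in 𝓝[Θ] θ₁, ∀ n, ∀ x : Fin n → ℝ,
      |x ⬝ᵥ (covMatrix K f n θ).mulVec x - x ⬝ᵥ (covMatrix K f n θ₁).mulVec x|
        ≤ c * τ / 2 * ∑ i, x i ^ 2 := fun θ₁ hθ₁ => by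
    filter_upwards [self_mem_nhdsWithin, eventually_abs_kernel_sub_le hγ'0.le hγ' hρ₀
      (fun g => (hdiff g).continuousOn) hC3 hC10 hT hθ₁ (show 0 < c * τ / 2 / S' by positivity)]
      with θ hθ h n x
    have h := abs_dotProduct_covMatrix_sub_le hstat f f hθ₁ hθ (by positivity) (hS' n)
      (fun i j => h _ ⟨n, i, j, rfl⟩) x
    rwa [div_mul_cancel₀ _ (by positivity)] at h
  have hclosed : IsClosed {θ : EuclideanSpace ℝ (Fin p) | ε ≤ dist θ θ₀} :=
    isClosed_le continuous_const (by fun_prop)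
  obtain ⟨t, htΘ, htcov⟩ := (hΘ.inter_right hclosed).elim_nhdsWithin_subcover _
    (fun θ₁ hθ₁ => nhdsWithin_mono _ Set.inter_subset_left (hloc θ₁ hθ₁.1))
  classical
  refine tendsto_measure_zero_of_subset_biUnion P (insert θ₀ t) (F := fun θ₁ n => {ω | η * n ≤
    |y n ω ⬝ᵥ (covMatrix K f n θ₁)⁻¹.mulVec (y n ω)
      - ((covMatrix K f n θ₁)⁻¹ * covMatrix K f n θ₀).trace|}) (fun θ₁ hθ₁ => ?_) ?_
  · have hθ₁Θ : θ₁ ∈ Θ := by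
      rcases Finset.mem_insert.1 hθ₁ with rfl | h
      exacts [hθ₀Θ, (htΘ _ h).1]
    have hlim : Tendsto (fun n : ℕ => ENNReal.ofReal (2 * b ^ 2 / η ^ 2 * (1 / (n : ℝ))))
        atTop (𝓝 0) := by
      have h := ENNReal.tendsto_ofReal
        (tendsto_one_div_atTop_nhds_zero_nat (𝕜 := ℝ).const_mul (2 * b ^ 2 / η ^ 2))
      rwa [mul_zero, ENNReal.ofReal_zero] at h
    refine tendsto_of_tendsto_of_tendsto_of_le_of_le' tendsto_const_nhds hlim
      (Eventually.of_forall fun n => zero_le) ?_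
    filter_upwards [eventually_gt_atTop 0] with n hn
    exact measure_le_abs_quadratic_form_sub_trace_le hn (hherm n θ₁ hθ₁Θ)
      (hherm n θ₀ hθ₀Θ) hc (hC4 n θ₁ hθ₁Θ) (hC4 n θ₀ hθ₀Θ) (hCu n θ₀ hθ₀Θ) (hy n) (hgauss n) hη
  · filter_upwards [eventually_gt_atTop 0, hβgap, hnoise] with n hn hgap hnoise ω hω
    by_contra hbad
    simp only [Set.mem_iUnion, not_exists, Set.mem_ofPred_eq, not_le] at hbad
    have hclose : ∀ θ₁ ∈ Θ, ∀ θ ∈ Θ, (∀ x : Fin n → ℝ,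
        |x ⬝ᵥ (covMatrix K f n θ).mulVec x - x ⬝ᵥ (covMatrix K f n θ₁).mulVec x|
          ≤ c * τ / 2 * ∑ i, x i ^ 2) → ∀ x : Fin n → ℝ,
        |x ⬝ᵥ (covMatrix K (fun m i => fapp m (N m) i) n θ).mulVec x
          - x ⬝ᵥ (covMatrix K f n θ₁).mulVec x| ≤ τ * (x ⬝ᵥ (covMatrix K f n θ₁).mulVec x) :=
      fun θ₁ hθ₁ θ hθ h x => by
        refine (abs_sub_le _ _ _).trans ((add_le_add (hnoise θ hθ x) (h x)).trans ?_)
        have := mul_le_mul_of_nonneg_left (hC4 n θ₁ hθ₁ x) hτ.le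
        linarith
    have hωε : ε ≤ dist (θhat n ω) θ₀ := by
      rw [Set.mem_ofPred_eq] at hω
      exact hω.le
    obtain ⟨θ₁, hθ₁t, hθ₁⟩ := Set.mem_iUnion₂.1 (htcov ⟨hmem n ω, hωε⟩)
    obtain ⟨hθ₁Θ, hθ₁ε⟩ := htΘ θ₁ hθ₁t
    refine (hmin n ω θ₀ hθ₀Θ).not_gt (likelihood_lt_of_klDiv_gap hn (hpos n θ₁ hθ₁Θ)
      (hpos n θ₀ hθ₀Θ) (covMatrix_isHermitian hstat _ (hmem n ω) n)
      (covMatrix_isHermitian hstat _ hθ₀Θ n) hτ.le (min_le_left _ _) (min_le_left _ _)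
      (hclose θ₁ hθ₁Θ _ (hmem n ω) (hθ₁ n))
      (hclose θ₀ hθ₀Θ _ hθ₀Θ fun x => by rw [sub_self, abs_zero]; positivity)
      (trace_inv_mul_le (hherm n θ₁ hθ₁Θ) (hherm n θ₀ hθ₀Θ) hc (hC4 n θ₁ hθ₁Θ) (hC4 n θ₀ hθ₀Θ)
        (hCu n θ₀ hθ₀Θ)) ?_ hsmall (hbad θ₁ (Finset.mem_insert_of_mem hθ₁t))
      (hbad θ₀ (Finset.mem_insert_self _ _)))
    have hkl := sum_sq_sub_le_mul_klDiv (hherm n θ₁ hθ₁Θ) (hherm n θ₀ hθ₀Θ) hc hC.le (hC4 n θ₁ hθ₁Θ)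
      (hCu n θ₁ hθ₁Θ) (hC4 n θ₀ hθ₀Θ) (hCu n θ₀ hθ₀Θ)
    have hβn := hgap θ₁ hθ₁Θ hθ₁ε
    rw [one_div, le_inv_mul_iff₀ (Nat.cast_pos.2 hn)] at hβn
    rw [hg, div_mul_eq_mul_div, div_le_iff₀' (by positivity), mul_comm β]
    exact hβn.trans hkl
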